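/- Let n ≥ 2, 1 ≤ p, q ≤ ∞ and r > 1. Then there is NO constant C > 0 such that ‖Tr f‖_{M^0_{p,q}(ℝ^{n−1})} ≤ C ‖f‖_{M^0_{p,q,r}(ℝⁿ)} holds for all Schwartz functions f ∈ 𝒮(ℝⁿ). -/

import Mathlib

open MeasureTheory FourierTransform
open scoped ENNReal NNReal

noncomputable section

/-- `η` is an admissible bump function: smooth, valued in `[0,1]`, equal to `1` on `|t| ≤ 1`
and vanishing for `|t| ≥ 2`. -/
def IsBump (η : ℝ → ℝ) : Prop :=
  ContDiff ℝ (⊤ : ℕ∞) η ∧ (∀ t, η t ∈ Set.Icc (0:ℝ) 1) ∧ (∀ t, |t| ≤ 1 → η t = 1) ∧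
    (∀ t, 2 ≤ |t| → η t = 0)

/-- Japanese bracket `⟨k⟩ = (1+|k|²)^{1/2}` of an integer vector. -/
def jbr {d : ℕ} (k : Fin d → ℤ) : ℝ := (1 + ∑ i, ((k i : ℝ))^2) ^ ((1:ℝ)/2)

/-- `ψ_k`, the normalized window at frequency `k ∈ ℤ^d`. -/
def unifWindow (η : ℝ → ℝ) {d : ℕ} (k : Fin d → ℤ) (ξ : EuclideanSpace ℝ (Fin d)) : ℝ :=
  (∏ i, η (2 * (ξ i - k i))) / ∑' l : Fin d → ℤ, ∏ i, η (2 * (ξ i - l i))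

/-- The frequency-uniform decomposition operator `□_k f = 𝓕⁻¹(ψ_k 𝓕 f)`. -/
def unifBox (η : ℝ → ℝ) {d : ℕ} (k : Fin d → ℤ) (f : EuclideanSpace ℝ (Fin d) → ℂ) :
    EuclideanSpace ℝ (Fin d) → ℂ :=
  𝓕⁻ (fun ξ => (unifWindow η k ξ : ℂ) * 𝓕 f ξ)

/-- The `ℓ^q` combination of a family of extended nonnegative reals, with the supremum
modification for `q = ∞`. -/
def lqSum {ι : Type*} (q : ℝ≥0∞) (a : ι → ℝ≥0∞) : ℝ≥0∞ :=
  if q = ∞ then ⨆ i, a i else (∑' i, a i ^ q.toReal) ^ (1 / q.toReal)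

/-- The modulation space quasi-norm `‖f‖_{M^s_{p,q}(ℝ^d)}`. -/
def modNorm (η : ℝ → ℝ) {d : ℕ} (s : ℝ) (p q : ℝ≥0∞) (f : EuclideanSpace ℝ (Fin d) → ℂ) :
    ℝ≥0∞ :=
  lqSum q (fun k : Fin d → ℤ =>
    ENNReal.ofReal (jbr k ^ s) * eLpNorm (unifBox η k f) p volume)

/-- The anisotropic modulation space quasi-norm `‖f‖_{M^s_{p,q,r}(ℝ^{m+1})}`. -/
def modNormAniso (η : ℝ → ℝ) {m : ℕ} (s : ℝ) (p q r : ℝ≥0∞)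
    (f : EuclideanSpace ℝ (Fin (m+1)) → ℂ) : ℝ≥0∞ :=
  lqSum r (fun kn : ℤ => lqSum q (fun kb : Fin m → ℤ =>
    ENNReal.ofReal (jbr kb ^ s) *
      eLpNorm (unifBox η (Fin.snoc kb kn) f) p volume))

/-- The trace `(Tr f)(x̄) = f(x̄, 0)` on the hyperplane `x_n = 0`. -/
def traceFn {m : ℕ} (f : EuclideanSpace ℝ (Fin (m+1)) → ℂ)
    (x : EuclideanSpace ℝ (Fin m)) : ℂ :=
  f ((WithLp.equiv 2 (Fin (m+1) → ℝ)).symm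
      (Fin.snoc ((WithLp.equiv 2 (Fin m → ℝ)) x) 0))


section aux

variable {η : ℝ → ℝ} {d : ℕ}

lemma aux_term_zero (hη : IsBump η) (l : Fin d → ℤ) (ξ : EuclideanSpace ℝ (Fin d))
    (i : Fin d) (h : 1 ≤ |ξ i - l i|) : ∏ i, η (2 * (ξ i - l i)) = 0 := by
  refine Finset.prod_eq_zero (Finset.mem_univ i) (hη.2.2.2 _ ?_)
  rw [abs_mul, abs_two]; linarith

/-- a finite box of lattice points near `ξ₀`. -/
def nearBox (ξ₀ : EuclideanSpace ℝ (Fin d)) : Finset (Fin d → ℤ) :=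
  Fintype.piFinset (fun i => Finset.Icc (⌊ξ₀ i⌋ - 2) (⌊ξ₀ i⌋ + 3))

lemma aux_den_eq (hη : IsBump η) (ξ₀ ξ : EuclideanSpace ℝ (Fin d))
    (h : ∀ i, |ξ i - ξ₀ i| < 1) :
    ∑' l : Fin d → ℤ, ∏ i, η (2 * (ξ i - l i)) =
      ∑ l ∈ nearBox ξ₀, ∏ i, η (2 * (ξ i - l i)) := by
  refine tsum_eq_sum fun l hl => ?_
  simp only [nearBox, Fintype.mem_piFinset, not_forall, Finset.mem_Icc] at hl
  obtain ⟨i, hi⟩ := hl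
  refine aux_term_zero hη l ξ i ?_
  by_contra hc
  push Not at hc
  apply hi
  have h1 := abs_lt.1 hc
  have h2 := abs_lt.1 (h i)
  have h3 := Int.floor_le (ξ₀ i)
  have h4 := Int.lt_floor_add_one (ξ₀ i)
  constructor
  · have : ((⌊ξ₀ i⌋ : ℝ)) - 2 < (l i : ℝ) := by linarith
    have : (⌊ξ₀ i⌋) - 2 < (l i) := by exact_mod_cast this
    omega
  · have : (l i : ℝ) < ((⌊ξ₀ i⌋ : ℝ)) + 3 := by linarith
    have : (l i) < (⌊ξ₀ i⌋) + 3 := by exact_mod_cast this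
    omega

lemma aux_term_contDiff (hη : IsBump η) (l : Fin d → ℤ) :
    ContDiff ℝ (⊤ : ℕ∞)
      (fun ξ : EuclideanSpace ℝ (Fin d) => ∏ i, η (2 * (ξ i - l i))) := by
  refine contDiff_prod fun i _ => hη.1.comp ?_
  fun_prop

lemma aux_den_contDiff (hη : IsBump η) :
    ContDiff ℝ (⊤ : ℕ∞) (fun ξ : EuclideanSpace ℝ (Fin d) =>
      ∑' l : Fin d → ℤ, ∏ i, η (2 * (ξ i - l i))) := by
  rw [contDiff_iff_contDiffAt]
  intro ξ₀
  have h1 : ContDiffAt ℝ (⊤ : ℕ∞) (fun ξ : EuclideanSpace ℝ (Fin d) =>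
      ∑ l ∈ nearBox ξ₀, ∏ i, η (2 * (ξ i - l i))) ξ₀ :=
    (ContDiff.sum fun l _ => aux_term_contDiff hη l).contDiffAt
  refine h1.congr_of_eventuallyEq ?_
  have : ∀ᶠ ξ : EuclideanSpace ℝ (Fin d) in nhds ξ₀, ∀ i, |ξ i - ξ₀ i| < 1 := by
    rw [Filter.eventually_all]
    intro i
    have hc : Continuous (fun ξ : EuclideanSpace ℝ (Fin d) => |ξ i - ξ₀ i|) := by fun_prop
    refine hc.continuousAt.eventually_lt continuousAt_const ?_
    simp
  filter_upwards [this] with ξ hξ using aux_den_eq hη ξ₀ ξ hξ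

lemma aux_den_ge (hη : IsBump η) (ξ : EuclideanSpace ℝ (Fin d)) :
    1 ≤ ∑' l : Fin d → ℤ, ∏ i, η (2 * (ξ i - l i)) := by
  rw [aux_den_eq hη ξ ξ (by simp)]
  have hnn : ∀ l : Fin d → ℤ, 0 ≤ ∏ i, η (2 * (ξ i - l i)) := fun l =>
    Finset.prod_nonneg fun i _ => (hη.2.1 _).1
  have h1 : ∏ i, η (2 * (ξ i - (round (ξ i) : ℤ))) = 1 := by
    refine Finset.prod_eq_one fun i _ => hη.2.2.1 _ ?_
    rw [abs_mul, abs_two]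
    have := abs_sub_round (ξ i)
    linarith
  by_cases hm : (fun i => round (ξ i)) ∈ nearBox ξ
  · calc (1:ℝ) = ∏ i, η (2 * (ξ i - ((fun i => round (ξ i)) i : ℤ))) := h1.symm
      _ ≤ _ := Finset.single_le_sum (f := fun l : Fin d → ℤ => ∏ i, η (2 * (ξ i - l i)))
        (fun l _ => hnn l) hm
  · exfalso
    apply hm
    simp only [nearBox, Fintype.mem_piFinset, Finset.mem_Icc]
    intro i
    have h1 := abs_le.1 (abs_sub_round (ξ i))
    have h3 := Int.floor_le (ξ i)
    have h4 := Int.lt_floor_add_one (ξ i)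
    constructor
    · have : ((⌊ξ i⌋ : ℝ)) - 2 < (round (ξ i) : ℝ) := by linarith
      have : (⌊ξ i⌋) - 2 < (round (ξ i)) := by exact_mod_cast this
      omega
    · have : (round (ξ i) : ℝ) < ((⌊ξ i⌋ : ℝ)) + 3 := by linarith
      have : (round (ξ i)) < (⌊ξ i⌋) + 3 := by exact_mod_cast this
      omega

lemma window_contDiff (hη : IsBump η) (k : Fin d → ℤ) :
    ContDiff ℝ (⊤ : ℕ∞) (unifWindow η k) := by
  refine (aux_term_contDiff hη k).div (aux_den_contDiff hη) fun ξ => ?_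
  have := aux_den_ge hη ξ
  intro h
  linarith [h ▸ this]

lemma window_zero (hη : IsBump η) (k : Fin d → ℤ) (ξ : EuclideanSpace ℝ (Fin d))
    (i : Fin d) (h : 1 ≤ |ξ i - k i|) : unifWindow η k ξ = 0 := by
  rw [unifWindow, aux_term_zero hη k ξ i h, zero_div]

lemma window_compact (hη : IsBump η) (k : Fin d → ℤ) :
    HasCompactSupport (unifWindow η k) := by
  have hK : IsCompact (Metric.closedBall (0 : EuclideanSpace ℝ (Fin d))
      (Real.sqrt (∑ i, (|(k i : ℝ)| + 1) ^ 2))) := isCompact_closedBall _ _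
  refine HasCompactSupport.intro hK fun ξ hξ => ?_
  by_contra hne
  apply hξ
  rw [mem_closedBall_zero_iff, EuclideanSpace.norm_eq]
  refine Real.sqrt_le_sqrt (Finset.sum_le_sum fun i _ => ?_)
  refine pow_le_pow_left₀ (norm_nonneg _) ?_ 2
  by_contra hc
  push Not at hc
  apply hne
  refine window_zero hη k ξ i ?_
  have := abs_sub_abs_le_abs_sub (ξ i) (k i)
  rw [Real.norm_eq_abs] at hc
  linarith

lemma window_shift (k : Fin d → ℤ) (v : Fin d → ℤ) (ξ w : EuclideanSpace ℝ (Fin d))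
    (hw : ∀ i, w i = v i) : unifWindow η k ξ = unifWindow η (k - v) (ξ - w) := by
  unfold unifWindow
  congr 1
  · refine Finset.prod_congr rfl fun i _ => ?_
    congr 1
    simp [hw]
  · rw [← (Equiv.addRight v).tsum_eq]
    refine tsum_congr fun l => Finset.prod_congr rfl fun i _ => ?_
    congr 1
    simp [hw]
    ring

lemma window_exists (hη : IsBump η) (ξ : EuclideanSpace ℝ (Fin d)) :
    ∃ k : Fin d → ℤ, unifWindow η k ξ ≠ 0 := by
  refine ⟨fun i => round (ξ i), ?_⟩
  have h1 : ∏ i, η (2 * (ξ i - (round (ξ i) : ℤ))) = 1 := by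
    refine Finset.prod_eq_one fun i _ => hη.2.2.1 _ ?_
    rw [abs_mul, abs_two]
    have := abs_sub_round (ξ i)
    linarith
  have := aux_den_ge hη ξ
  unfold unifWindow
  rw [h1]
  positivity

/-- `ψ_k F` as a Schwartz function. -/
def winS (hη : IsBump η) (k : Fin d → ℤ) (F : SchwartzMap (EuclideanSpace ℝ (Fin d)) ℂ) :
    SchwartzMap (EuclideanSpace ℝ (Fin d)) ℂ :=
  HasCompactSupport.toSchwartzMap (f := fun ξ => (unifWindow η k ξ : ℂ) * F ξ)
    (by
      have h := (window_compact hη k).comp_left (g := fun x : ℝ => (x : ℂ)) (by simp)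
      exact h.mul_right)
    (by
      exact (Complex.ofRealCLM.contDiff.comp (window_contDiff hη k)).mul (F.smooth _))

lemma winS_apply (hη : IsBump η) (k : Fin d → ℤ)
    (F : SchwartzMap (EuclideanSpace ℝ (Fin d)) ℂ) (ξ : EuclideanSpace ℝ (Fin d)) :
    winS hη k F ξ = (unifWindow η k ξ : ℂ) * F ξ := rfl

/-- `𝓕⁻ (ψ_k F)` as a Schwartz function. -/
def boxS (hη : IsBump η) (k : Fin d → ℤ) (F : SchwartzMap (EuclideanSpace ℝ (Fin d)) ℂ) :
    SchwartzMap (EuclideanSpace ℝ (Fin d)) ℂ := 𝓕⁻ (winS hη k F)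

lemma unifBox_eq (hη : IsBump η) (k : Fin d → ℤ)
    (f : SchwartzMap (EuclideanSpace ℝ (Fin d)) ℂ) :
    unifBox η k (⇑f) = ⇑(boxS hη k (𝓕 f)) := by
  rw [boxS, SchwartzMap.fourierInv_coe]
  unfold unifBox
  congr 1

lemma box_shift (G H : EuclideanSpace ℝ (Fin d) → ℂ) (w x : EuclideanSpace ℝ (Fin d))
    (h : ∀ ξ, G ξ = H (ξ - w)) :
    𝓕⁻ G x = (Real.fourierChar (inner ℝ w x) : ℂ) * 𝓕⁻ H x := by
  rw [Real.fourierInv_eq, Real.fourierInv_eq]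
  rw [← integral_add_right_eq_self _ w, ← integral_const_mul]
  congr 1
  ext v
  rw [h, add_sub_cancel_right, inner_add_left, AddChar.map_add_eq_mul]
  simp only [Circle.smul_def, Circle.coe_mul, smul_eq_mul]
  ring

lemma lqSum_mono {ι : Type*} (q : ℝ≥0∞) {a b : ι → ℝ≥0∞} (h : ∀ i, a i ≤ b i) :
    lqSum q a ≤ lqSum q b := by
  unfold lqSum
  split_ifs
  · exact iSup_mono h
  · gcongr
    exact h _

lemma le_lqSum {ι : Type*} (q : ℝ≥0∞) (hq : 1 ≤ q) (a : ι → ℝ≥0∞) (i : ι) :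
    a i ≤ lqSum q a := by
  unfold lqSum
  split_ifs with h
  · exact le_iSup a i
  · have hq0 : 0 < q.toReal := ENNReal.toReal_pos (by positivity) h
    calc a i = (a i ^ q.toReal) ^ (1 / q.toReal) := by
          rw [← ENNReal.rpow_mul, mul_one_div_cancel hq0.ne', ENNReal.rpow_one]
      _ ≤ _ := by
        gcongr
        exact ENNReal.le_tsum (f := fun i => a i ^ q.toReal) i

lemma lqSum_le {ι : Type*} (q : ℝ≥0∞) (hq : 1 ≤ q) (a : ι → ℝ≥0∞) (S : Finset ι) (B : ℝ≥0∞)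
    (h0 : ∀ i ∉ S, a i = 0) (hB : ∀ i, a i ≤ B) :
    lqSum q a ≤ (S.card : ℝ≥0∞) ^ (1 / q.toReal) * B := by
  unfold lqSum
  split_ifs with h
  · simp only [h, ENNReal.toReal_top, div_zero, ENNReal.rpow_zero, one_mul]
    exact iSup_le hB
  · have hq0 : 0 < q.toReal := ENNReal.toReal_pos (by positivity) h
    rw [tsum_eq_sum (s := S) (fun i hi => by rw [h0 i hi, ENNReal.zero_rpow_of_pos hq0])]
    calc (∑ i ∈ S, a i ^ q.toReal) ^ (1 / q.toReal)
        ≤ (∑ i ∈ S, B ^ q.toReal) ^ (1 / q.toReal) := by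
          gcongr
          exact hB _
      _ = _ := by
        rw [Finset.sum_const, nsmul_eq_mul, ENNReal.mul_rpow_of_nonneg _ _ (by positivity),
          ← ENNReal.rpow_mul, mul_one_div_cancel hq0.ne', ENNReal.rpow_one]

lemma lqSum_zero {ι : Type*} (q : ℝ≥0∞) (hq : 1 ≤ q) (a : ι → ℝ≥0∞) (h : ∀ i, a i = 0) :
    lqSum q a = 0 := by
  have := lqSum_le q hq a ∅ 0 (fun i _ => h i) (fun i => (h i).le)
  simpa using this

/-- Some frequency-uniform piece of a nonzero Schwartz function is nonzero. -/
lemma exists_box_ne_zero (hη : IsBump η) (p : ℝ≥0∞) (hp : 1 ≤ p)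
    (g : SchwartzMap (EuclideanSpace ℝ (Fin d)) ℂ) (hg : g ≠ 0) :
    ∃ k : Fin d → ℤ, eLpNorm (⇑(boxS hη k (𝓕 g))) p volume ≠ 0 := by
  by_contra hc
  push Not at hc
  apply hg
  have h1 : 𝓕 g = 0 := by
    ext ξ
    obtain ⟨k, hk⟩ := window_exists hη ξ
    have h2 := hc k
    rw [eLpNorm_eq_zero_iff (SchwartzMap.continuous _).aestronglyMeasurable
      (by positivity)] at h2
    have h3 : (⇑(boxS hη k (𝓕 g)) : EuclideanSpace ℝ (Fin d) → ℂ) = 0 :=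
      (Continuous.ae_eq_iff_eq volume (SchwartzMap.continuous _) continuous_const).1 h2
    have h4 : boxS hη k (𝓕 g) = 0 := by
      ext x; exact congrFun h3 x
    have h5 : winS hη k (𝓕 g) = 0 := by
      rw [boxS] at h4
      have h7 := FourierTransform.fourier_fourierInv_eq
        (F := (SchwartzMap (EuclideanSpace ℝ (Fin d)) ℂ))
        (E := (SchwartzMap (EuclideanSpace ℝ (Fin d)) ℂ)) (winS hη k (𝓕 g))
      rw [← h7, h4, FourierTransform.fourier_zero]
    have h6 : winS hη k (𝓕 g) ξ = 0 := by rw [h5]; rfl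
    rw [winS_apply] at h6
    rcases mul_eq_zero.1 h6 with h | h
    · exact absurd (by exact_mod_cast h) hk
    · exact h
  have h7 := FourierTransform.fourierInv_fourier_eq
    (E := (SchwartzMap (EuclideanSpace ℝ (Fin d)) ℂ)) (F := (SchwartzMap (EuclideanSpace ℝ (Fin d)) ℂ)) g
  rw [← h7, h1, FourierTransform.fourierInv_zero]

/-- The embedding of the hyperplane. -/
def hypEmb (m : ℕ) : EuclideanSpace ℝ (Fin m) →ₗᵢ[ℝ] EuclideanSpace ℝ (Fin (m+1)) where
  toFun x := (WithLp.equiv 2 (Fin (m+1) → ℝ)).symm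
      (Fin.snoc ((WithLp.equiv 2 (Fin m → ℝ)) x) 0)
  map_add' x y := by
    ext i
    refine Fin.lastCases ?_ (fun j => ?_) i <;> simp
  map_smul' c x := by
    ext i
    refine Fin.lastCases ?_ (fun j => ?_) i <;> simp
  norm_map' x := by
    simp [EuclideanSpace.norm_eq, Fin.sum_univ_castSucc]

/-- The trace as a Schwartz function. -/
def traceS {m : ℕ} (f : SchwartzMap (EuclideanSpace ℝ (Fin (m+1))) ℂ) :
    SchwartzMap (EuclideanSpace ℝ (Fin m)) ℂ :=
  SchwartzMap.compCLMOfAntilipschitz ℝ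
    ((hypEmb m).toContinuousLinearMap.hasTemperateGrowth) (hypEmb m).antilipschitz f

lemma traceS_coe {m : ℕ} (f : SchwartzMap (EuclideanSpace ℝ (Fin (m+1))) ℂ) :
    traceFn (⇑f) = ⇑(traceS f) := rfl

/-- The frequency bump at `w`. -/
def bumpS (w : EuclideanSpace ℝ (Fin d)) : SchwartzMap (EuclideanSpace ℝ (Fin d)) ℂ :=
  let b : ContDiffBump w := ⟨1/2, 1, by norm_num, by norm_num⟩
  HasCompactSupport.toSchwartzMap (f := fun ξ => ((b ξ : ℝ) : ℂ))
    (b.hasCompactSupport.comp_left (g := fun x : ℝ => (x : ℂ)) (by simp))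
    (Complex.ofRealCLM.contDiff.comp b.contDiff)

lemma bumpS_shift (w ξ : EuclideanSpace ℝ (Fin d)) : bumpS w ξ = bumpS 0 (ξ - w) := by
  change (((⟨1/2, 1, by norm_num, by norm_num⟩ : ContDiffBump w) ξ : ℝ) : ℂ)
    = (((⟨1/2, 1, by norm_num, by norm_num⟩ :
      ContDiffBump (0 : EuclideanSpace ℝ (Fin d))) (ξ - w) : ℝ) : ℂ)
  simp [ContDiffBump.apply]

lemma bumpS_zero (ξ : EuclideanSpace ℝ (Fin d)) (h : 1 ≤ ‖ξ‖) : bumpS 0 ξ = 0 := by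
  change (((⟨1/2, 1, by norm_num, by norm_num⟩ :
      ContDiffBump (0 : EuclideanSpace ℝ (Fin d))) ξ : ℝ) : ℂ) = 0
  rw [ContDiffBump.zero_of_le_dist]
  · simp
  · simpa using h

lemma bumpS_inv_zero : (𝓕⁻ (bumpS (0 : EuclideanSpace ℝ (Fin d)))) 0 ≠ 0 := by
  rw [SchwartzMap.fourierInv_coe, Real.fourierInv_eq]
  simp only [inner_zero_right, AddChar.map_zero_eq_one, one_smul]
  let b : ContDiffBump (0 : EuclideanSpace ℝ (Fin d)) := ⟨1/2, 1, by norm_num, by norm_num⟩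
  change ∫ ξ, ((b ξ : ℝ) : ℂ) ≠ 0
  rw [integral_complex_ofReal]
  exact_mod_cast b.integral_pos.ne'

end aux

section main

variable {η : ℝ → ℝ}

lemma boxS_sum {d : ℕ} (hη : IsBump η) (k : Fin d → ℤ) (N : ℕ)
    (F : ℕ → SchwartzMap (EuclideanSpace ℝ (Fin d)) ℂ) :
    boxS hη k (∑ j ∈ Finset.range N, F j) = ∑ j ∈ Finset.range N, boxS hη k (F j) := by
  unfold boxS
  rw [← FourierTransform.fourierInv_sum]
  congr 1
  ext ξ
  simp [winS_apply, Finset.mul_sum]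

lemma boxS_smul {d : ℕ} (hη : IsBump η) (k : Fin d → ℤ) (c : ℂ)
    (F : SchwartzMap (EuclideanSpace ℝ (Fin d)) ℂ) :
    boxS hη k (c • F) = c • boxS hη k F := by
  unfold boxS
  rw [← FourierTransform.fourierInv_smul]
  congr 1
  ext ξ
  simp [winS_apply]
  ring

/-- the integer vector `j e_n` -/
def lastZ (m : ℕ) (j : ℕ) : Fin (m+1) → ℤ := Fin.snoc (fun _ => 0) (j : ℤ)

/-- the vector `j e_n` -/
def lastV (m : ℕ) (j : ℕ) : EuclideanSpace ℝ (Fin (m+1)) :=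
  WithLp.toLp 2 (fun i => ((lastZ m j i : ℤ) : ℝ))

lemma snoc_sub_lastZ {m : ℕ} (kb : Fin m → ℤ) (kn : ℤ) (j : ℕ) :
    (Fin.snoc kb kn : Fin (m+1) → ℤ) - lastZ m j = Fin.snoc kb (kn - j) := by
  ext i
  refine Fin.lastCases ?_ (fun j => ?_) i <;> simp [lastZ]

lemma eLpNorm_box_shift {m : ℕ} (hη : IsBump η) (p : ℝ≥0∞) (k : Fin (m+1) → ℤ) (j : ℕ) :
    eLpNorm (⇑(boxS hη k (bumpS (lastV m j)))) p volume =
      eLpNorm (⇑(boxS hη (k - lastZ m j) (bumpS 0))) p volume := by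
  refine eLpNorm_congr_norm_ae (Filter.Eventually.of_forall fun x => ?_)
  unfold boxS
  rw [SchwartzMap.fourierInv_coe, SchwartzMap.fourierInv_coe,
    box_shift (winS hη k (bumpS (lastV m j))) (winS hη (k - lastZ m j) (bumpS 0))
      (lastV m j) x]
  · rw [norm_mul, Circle.norm_coe, one_mul]
  · intro ξ
    rw [winS_apply, winS_apply, bumpS_shift,
      window_shift k (lastZ m j) ξ (lastV m j) (fun i => rfl)]

lemma box_bump_zero {d : ℕ} (hη : IsBump η) (k : Fin d → ℤ) (i : Fin d)
    (h : k i ∉ Finset.Icc (-1 : ℤ) 1) : boxS hη k (bumpS 0) = 0 := by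
  have : winS hη k (bumpS 0) = 0 := by
    ext ξ
    rw [winS_apply]
    by_cases h1 : 1 ≤ ‖ξ‖
    · rw [bumpS_zero ξ h1, mul_zero]; rfl
    · have h2 : |ξ i| < 1 := lt_of_le_of_lt (PiLp.norm_apply_le ξ i) (not_le.1 h1)
      rw [window_zero hη k ξ i]
      · simp
      · have h3 : (2 : ℝ) ≤ |(k i : ℝ)| := by
          have : 2 ≤ |k i| := by
            by_contra hc
            apply h
            rw [Finset.mem_Icc]
            rw [not_le] at hc
            have := abs_lt.1 hc
            omega
          exact_mod_cast this
        have h4 := abs_sub_abs_le_abs_sub (k i : ℝ) (ξ i)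
        rw [abs_sub_comm] at h4
        linarith
  rw [boxS, this, FourierTransform.fourierInv_zero]

/-- `f_N` on the Fourier side. -/
def FN (m N : ℕ) : SchwartzMap (EuclideanSpace ℝ (Fin (m+1))) ℂ :=
  ∑ j ∈ Finset.range N, bumpS (lastV m j)

/-- `f_N`. -/
def fN (m N : ℕ) : SchwartzMap (EuclideanSpace ℝ (Fin (m+1))) ℂ := 𝓕⁻ (FN m N)

lemma fourier_fN (m N : ℕ) : 𝓕 (fN m N) = FN m N :=
  FourierTransform.fourier_fourierInv_eq
        (F := SchwartzMap (EuclideanSpace ℝ (Fin (m+1))) ℂ)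
        (E := SchwartzMap (EuclideanSpace ℝ (Fin (m+1))) ℂ) (FN m N)

/-- the limit trace profile -/
def g0 (m : ℕ) : SchwartzMap (EuclideanSpace ℝ (Fin m)) ℂ := traceS (𝓕⁻ (bumpS 0))

lemma g0_ne (m : ℕ) : g0 m ≠ 0 := by
  intro h
  have h1 : g0 m 0 = 0 := by rw [h]; rfl
  apply bumpS_inv_zero (d := m+1)
  have h2 : hypEmb m 0 = 0 := map_zero _
  have h3 : (𝓕⁻ (bumpS (0 : EuclideanSpace ℝ (Fin (m+1))))) (hypEmb m 0) = 0 := h1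
  rwa [h2] at h3

lemma inner_lastV (m j : ℕ) (x : EuclideanSpace ℝ (Fin m)) :
    inner ℝ (lastV m j) (hypEmb m x) = 0 := by
  rw [PiLp.inner_apply, Fin.sum_univ_castSucc]
  simp [lastV, lastZ, hypEmb]

lemma trace_fN (m N : ℕ) : traceS (fN m N) = (N : ℂ) • g0 m := by
  ext x
  change fN m N (hypEmb m x) = (N : ℂ) * (𝓕⁻ (bumpS 0)) (hypEmb m x)
  rw [fN, FN, FourierTransform.fourierInv_sum, _root_.sum_apply]
  rw [Finset.sum_congr rfl (g := fun _ => (𝓕⁻ (bumpS 0)) (hypEmb m x))]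
  · simp
  · intro j _
    rw [SchwartzMap.fourierInv_coe, SchwartzMap.fourierInv_coe,
      box_shift (bumpS (lastV m j)) (bumpS 0) (lastV m j) _ (bumpS_shift _), inner_lastV]
    simp

lemma lower (m N : ℕ) (hη : IsBump η) (p q : ℝ≥0∞) (hq : 1 ≤ q) (k : Fin m → ℤ) :
    N * eLpNorm (⇑(boxS hη k (𝓕 (g0 m)))) p volume ≤ modNorm η 0 p q (traceFn (⇑(fN m N))) := by
  refine le_trans (le_of_eq ?_) (le_lqSum q hq _ k)
  rw [traceS_coe, unifBox_eq hη, trace_fN, FourierTransform.fourier_smul, boxS_smul]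
  change _ = _ * eLpNorm ((N : ℂ) • ⇑(boxS hη k (𝓕 (g0 m)))) p volume
  rw [eLpNorm_const_smul]
  have hN : ‖(N : ℂ)‖ₑ = N := by
    rw [← ofReal_norm, Complex.norm_natCast, ENNReal.ofReal_natCast]
  simp [hN]

/-- `ℓ¹` sum in the last frequency. -/
def bsum {m : ℕ} (hη : IsBump η) (p : ℝ≥0∞) (kb : Fin m → ℤ) : ℝ≥0∞ :=
  ∑' i : ℤ, eLpNorm (⇑(boxS hη (Fin.snoc kb i : Fin (m+1) → ℤ) (bumpS 0))) p volume

lemma snoc_zero {m : ℕ} (hη : IsBump η) (p : ℝ≥0∞) (kb : Fin m → ℤ) (i : ℤ)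
    (h : i ∉ Finset.Icc (-1 : ℤ) 1) :
    eLpNorm (⇑(boxS hη (Fin.snoc kb i : Fin (m+1) → ℤ) (bumpS 0))) p volume = 0 := by
  rw [box_bump_zero hη _ (Fin.last m) (by simpa using h)]
  exact eLpNorm_zero

lemma bsum_ne_top {m : ℕ} (hη : IsBump η) (p : ℝ≥0∞) (kb : Fin m → ℤ) :
    bsum hη p kb ≠ ∞ := by
  unfold bsum
  rw [tsum_eq_sum (s := Finset.Icc (-1 : ℤ) 1) (fun i hi => snoc_zero hη p kb i hi)]
  exact ENNReal.sum_ne_top.2 fun i _ => (SchwartzMap.memLp _ p volume).eLpNorm_ne_top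

lemma bsum_zero {m : ℕ} (hη : IsBump η) (p : ℝ≥0∞) (kb : Fin m → ℤ)
    (h : kb ∉ Fintype.piFinset (fun _ : Fin m => Finset.Icc (-1 : ℤ) 1)) :
    bsum hη p kb = 0 := by
  simp only [Fintype.mem_piFinset, not_forall] at h
  obtain ⟨i, hi⟩ := h
  unfold bsum
  rw [ENNReal.tsum_eq_zero]
  intro j
  rw [box_bump_zero hη _ i.castSucc (by rw [Fin.snoc_castSucc]; exact hi)]
  exact eLpNorm_zero

lemma B_ne_top {m : ℕ} (hη : IsBump η) (p q : ℝ≥0∞) (hq : 1 ≤ q) :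
    lqSum q (bsum (m := m) hη p) ≠ ∞ := by
  set S := Fintype.piFinset (fun _ : Fin m => Finset.Icc (-1 : ℤ) 1)
  have h := lqSum_le q hq (bsum (m := m) hη p) S (∑ k ∈ S, bsum hη p k)
    (fun i hi => bsum_zero hη p i hi) (fun i => by
      by_cases hi : i ∈ S
      · exact Finset.single_le_sum (f := bsum hη p) (fun _ _ => zero_le) hi
      · rw [bsum_zero hη p i hi]; exact zero_le)
  refine ne_top_of_le_ne_top ?_ h
  refine ENNReal.mul_ne_top ?_ ?_
  · exact ENNReal.rpow_ne_top_of_nonneg (by positivity) (ENNReal.natCast_ne_top _)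
  · exact ENNReal.sum_ne_top.2 fun i _ => bsum_ne_top hη p i

lemma box_fN_le {m : ℕ} (N : ℕ) (hη : IsBump η) (p : ℝ≥0∞) (hp : 1 ≤ p) (kb : Fin m → ℤ)
    (kn : ℤ) :
    eLpNorm (unifBox η (Fin.snoc kb kn : Fin (m+1) → ℤ) (⇑(fN m N))) p volume ≤
      ∑ j ∈ Finset.range N, eLpNorm (⇑(boxS hη (Fin.snoc kb (kn - (j : ℤ)) : Fin (m+1) → ℤ)
        (bumpS 0))) p volume := by
  rw [unifBox_eq hη, fourier_fN, FN, boxS_sum]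
  have h1 : (⇑(∑ j ∈ Finset.range N,
      boxS hη (Fin.snoc kb kn : Fin (m+1) → ℤ) (bumpS (lastV m j))) :
      EuclideanSpace ℝ (Fin (m+1)) → ℂ) = ∑ j ∈ Finset.range N,
      ⇑(boxS hη (Fin.snoc kb kn : Fin (m+1) → ℤ) (bumpS (lastV m j))) := by
    ext x
    rw [_root_.sum_apply, Finset.sum_apply]
  rw [h1]
  refine (eLpNorm_sum_le (fun j _ => (SchwartzMap.continuous _).aestronglyMeasurable) hp).trans ?_
  refine Finset.sum_le_sum fun j _ => ?_
  rw [eLpNorm_box_shift, snoc_sub_lastZ]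

lemma upper (m N : ℕ) (hη : IsBump η) (p q r : ℝ≥0∞) (hp : 1 ≤ p) (hq : 1 ≤ q) (hr : 1 ≤ r) :
    modNormAniso η 0 p q r (⇑(fN m N)) ≤
      ((N + 2 : ℕ) : ℝ≥0∞) ^ (1 / r.toReal) * lqSum q (bsum (m := m) hη p) := by
  have hcard : (Finset.Icc (-1 : ℤ) N).card = N + 2 := by
    rw [Int.card_Icc]; omega
  rw [← hcard]
  refine lqSum_le r hr _ _ _ ?_ ?_
  · intro kn hkn
    refine lqSum_zero q hq _ fun kb => ?_
    refine mul_eq_zero_of_right _ (le_antisymm ((box_fN_le N hη p hp kb kn).trans ?_) (zero_le))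
    refine (Finset.sum_eq_zero fun j hj => snoc_zero hη p kb _ ?_).le
    rw [Finset.mem_range] at hj
    rw [Finset.mem_Icc] at hkn ⊢
    omega
  · intro kn
    refine lqSum_mono q fun kb => ?_
    simp only [Real.rpow_zero, ENNReal.ofReal_one, one_mul]
    refine (box_fN_le N hη p hp kb kn).trans ?_
    refine (ENNReal.sum_le_tsum _).trans ?_
    unfold bsum
    exact ENNReal.tsum_comp_le_tsum_of_injective
      (f := fun j : ℕ => kn - (j : ℤ)) (fun a b hab => by simpa using hab)
      (fun i : ℤ => eLpNorm (⇑(boxS hη (Fin.snoc kb i : Fin (m+1) → ℤ) (bumpS 0))) p volume)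

lemma growth (s : ℝ) (hs0 : 0 ≤ s) (hs : s < 1) (t c : ℝ) (ht : 0 < t)
    (h : ∀ N : ℕ, N * t ≤ c * ((N + 2 : ℕ) : ℝ) ^ s) : False := by
  have h1 : Filter.Tendsto (fun N : ℕ => (((N + 2 : ℕ) : ℝ)) ^ (1 - s)) Filter.atTop
      Filter.atTop :=
    ((tendsto_rpow_atTop (sub_pos.2 hs)).comp tendsto_natCast_atTop_atTop).comp
      (Filter.tendsto_add_atTop_nat 2)
  obtain ⟨N, hN, hN1⟩ := ((h1.eventually_gt_atTop (3 * c / t)).and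
    (Filter.eventually_ge_atTop 1)).exists
  have hM : (0 : ℝ) < ((N + 2 : ℕ) : ℝ) := by positivity
  have h2 : ((N + 2 : ℕ) : ℝ) ^ (1 - s) * ((N + 2 : ℕ) : ℝ) ^ s = ((N + 2 : ℕ) : ℝ) := by
    rw [← Real.rpow_add hM]; simp
  have h3 : (0 : ℝ) < ((N + 2 : ℕ) : ℝ) ^ s := Real.rpow_pos_of_pos hM s
  have h4 : ((N + 2 : ℕ) : ℝ) ≤ 3 * N := by
    have : N + 2 ≤ 3 * N := by omega
    exact_mod_cast this
  rw [div_lt_iff₀ ht] at hN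
  have h5 := mul_lt_mul_of_pos_right hN h3
  have h6 := h N
  have h7 := mul_le_mul_of_nonneg_right h4 ht.le
  rw [mul_right_comm (_ ^ (1 - s)) t, h2] at h5
  linarith

end main

/-- For `n = m+1 ≥ 2`, `1 ≤ p, q ≤ ∞` and `r > 1`, there is no constant
`C > 0` with `‖Tr f‖_{M^0_{p,q}(ℝ^{n-1})} ≤ C ‖f‖_{M^0_{p,q,r}(ℝⁿ)}` for all Schwartz `f`. -/
theorem trace_modulation_aniso_sharp
    (m : ℕ) (hm : 1 ≤ m) (η : ℝ → ℝ) (hη : IsBump η)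
    (p q r : ℝ≥0∞) (hp : 1 ≤ p) (hq : 1 ≤ q) (hr : 1 < r) :
    ¬ ∃ C : ℝ≥0∞, 0 < C ∧ C ≠ ∞ ∧
        ∀ f : SchwartzMap (EuclideanSpace ℝ (Fin (m+1))) ℂ,
          modNorm η 0 p q (traceFn (⇑f)) ≤ C * modNormAniso η 0 p q r (⇑f) := by
  rintro ⟨C, -, hC, h⟩
  obtain ⟨k, hk⟩ := exists_box_ne_zero hη p hp (g0 m) (g0_ne m)
  set T := eLpNorm (⇑(boxS hη k (𝓕 (g0 m)))) p volume with hT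
  have hTtop : T ≠ ∞ := (SchwartzMap.memLp _ p volume).eLpNorm_ne_top
  have hB := B_ne_top (m := m) hη p q hq
  set B := lqSum q (bsum (m := m) hη p) with hBdef
  have hs : 1 / r.toReal < 1 := by
    by_cases hrt : r = ∞
    · simp [hrt]
    · have h1 : 1 < r.toReal := by
        rw [← ENNReal.toReal_one]
        exact (ENNReal.toReal_lt_toReal ENNReal.one_ne_top hrt).2 hr
      rw [div_lt_one (by linarith)]
      exact h1
  refine growth (1 / r.toReal) (by positivity) hs T.toReal (C * B).toReal
    (ENNReal.toReal_pos hk hTtop) fun N => ?_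
  have h1 : (N : ℝ≥0∞) * T ≤ C * B * ((N + 2 : ℕ) : ℝ≥0∞) ^ (1 / r.toReal) := by
    calc (N : ℝ≥0∞) * T ≤ modNorm η 0 p q (traceFn (⇑(fN m N))) := lower m N hη p q hq k
      _ ≤ C * modNormAniso η 0 p q r (⇑(fN m N)) := h (fN m N)
      _ ≤ C * (((N + 2 : ℕ) : ℝ≥0∞) ^ (1 / r.toReal) * B) := by
        gcongr
        exact upper m N hη p q r hp hq hr.le
      _ = _ := by ring
  have h2 : C * B * ((N + 2 : ℕ) : ℝ≥0∞) ^ (1 / r.toReal) ≠ ∞ :=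
    ENNReal.mul_ne_top (ENNReal.mul_ne_top hC hB)
      (ENNReal.rpow_ne_top_of_nonneg (by positivity) (ENNReal.natCast_ne_top _))
  have h3 := ENNReal.toReal_mono h2 h1
  rw [ENNReal.toReal_mul, ENNReal.toReal_mul (a := C * B), ← ENNReal.toReal_rpow,
    ENNReal.toReal_natCast, ENNReal.toReal_natCast] at h3
  exact h3
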